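/- arXiv:1207.4638 — 7 statements merged into one kernel-verified Lean document; each statement's English description precedes it below -/
import Mathlib

section
/- Homotopy version of Proposition 7.3. Let n > d ≥ 1 be integers, let Γ ⊂ ℝⁿ be a closed set with H^d(Γ) = 0, and let (σ_j)_{j∈J} be a family of continuous maps from the unit sphere S^{d−1} to Γ. Let 𝓕 be the class of all closed sets F ⊂ ℝⁿ with Γ ⊂ F such that for every j ∈ J the map σ_j, viewed as a map into F, is nullhomotopic in F. Suppose E ∈ 𝓕 satisfies H^d(E) = inf_{F∈𝓕} H^d(F) < +∞. Then E is a sliding minimal set of dimension d with the single boundary piece Γ; that is, H^d(E ∩ B) ≤ H^d(φ₁(E) ∩ B) for every closed ball B ⊂ ℝⁿ and every sliding deformation (φ_t)_{0≤t≤1} of E in B. -/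
open MeasureTheory Metric Set

noncomputable section

abbrev Euc (n : ℕ) := EuclideanSpace ℝ (Fin n)

/-- The homotopy version of the Reifenberg class: a closed set `F ⊆ ℝⁿ` belongs to the
class when `Γ ⊆ F` and each of the given continuous maps `σ j : S^{d-1} → Γ`, viewed as a
map into `F`, is nullhomotopic in `F`. -/
def ReifenbergClass {n d : ℕ} {J : Type*} (Γ : Set (Euc n))
    (σ : J → C(↥(sphere (0 : EuclideanSpace ℝ (Fin d)) 1), ↥Γ))
    (F : Set (Euc n)) : Prop :=
  IsClosed F ∧ ∃ hsub : Γ ⊆ F, ∀ j : J,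
    ((⟨Set.inclusion hsub, continuous_inclusion hsub⟩ : C(↥Γ, ↥F)).comp (σ j)).Nullhomotopic

/-- A closed set stays closed under a map that is continuous on it and is the identity outside a
compact set. -/
theorem IsClosed.image_of_eqOn_id_diff {X : Type*} [TopologicalSpace X] [T2Space X]
    {E B : Set X} (hE : IsClosed E) (hB : IsCompact B) {f : X → X} (hf : ContinuousOn f E)
    (hid : ∀ y ∈ E \ B, f y = y) : IsClosed (f '' E) := by
  have hsub : closure (E \ B) ⊆ E := closure_minimal sdiff_subset hE
  have hcl : EqOn f id (closure (E \ B)) :=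
    EqOn.of_subset_closure hid (hf.mono hsub) continuousOn_id subset_closure subset_rfl
  have hEq : f '' E = closure (E \ B) ∪ f '' (E ∩ B) := by
    rw [← image_id (closure (E \ B)), ← hcl.image_eq, ← image_union]
    congr 1
    refine Subset.antisymm (fun y hy => ?_) (union_subset hsub inter_subset_left)
    by_cases hyB : y ∈ B
    · exact Or.inr ⟨hy, hyB⟩
    · exact Or.inl (subset_closure ⟨hy, hyB⟩)
  rw [hEq]
  exact isClosed_closure.union
    ((hB.inter_left hE).image_of_continuousOn (hf.mono inter_subset_left)).isClosed

/-- The Reifenberg class is stable under deformations that preserve `Γ`, once the boundary `Γ` is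
added to the deformed set. -/
theorem ReifenbergClass.image_union {n d : ℕ} {J : Type*} {Γ : Set (Euc n)}
    {σ : J → C(↥(sphere (0 : EuclideanSpace ℝ (Fin d)) 1), ↥Γ)} {E : Set (Euc n)}
    (hE : ReifenbergClass Γ σ E) {φ : ℝ → Euc n → Euc n}
    (hφ : ContinuousOn (fun p : ℝ × Euc n => φ p.1 p.2) (Icc (0 : ℝ) 1 ×ˢ E))
    (h0 : ∀ y ∈ E, φ 0 y = y) (hΓ : ∀ t ∈ Icc (0 : ℝ) 1, ∀ y ∈ E ∩ Γ, φ t y ∈ Γ)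
    (hclosed : IsClosed (φ 1 '' E ∪ Γ)) : ReifenbergClass Γ σ (φ 1 '' E ∪ Γ) := by
  obtain ⟨-, hsub, hnull⟩ := hE
  refine ⟨hclosed, subset_union_right, fun j => ?_⟩
  let k : C(↥E, ↥(φ 1 '' E ∪ Γ)) :=
    ⟨fun y => ⟨φ 1 y, Or.inl (mem_image_of_mem _ y.2)⟩,
      (hφ.comp_continuous (f := fun y : ↥E => ((1 : ℝ), (y : Euc n))) (by fun_prop)
        (fun y => ⟨right_mem_Icc.2 zero_le_one, y.2⟩)).subtype_mk _⟩
  let H : ContinuousMap.Homotopy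
      (⟨Set.inclusion subset_union_right, continuous_inclusion subset_union_right⟩ :
        C(↥Γ, ↥(φ 1 '' E ∪ Γ)))
      (k.comp ⟨Set.inclusion hsub, continuous_inclusion hsub⟩) :=
    { toFun := fun p => ⟨φ p.1 p.2, Or.inr (hΓ _ p.1.2 _ ⟨hsub p.2.2, p.2.2⟩)⟩
      continuous_toFun :=
        (hφ.comp_continuous
          (f := fun p : unitInterval × ↥Γ => ((p.1 : ℝ), (p.2 : Euc n))) (by fun_prop)
          (fun p => ⟨p.1.2, hsub p.2.2⟩)).subtype_mk _
      map_zero_left := fun y => Subtype.ext (h0 _ (hsub y.2))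
      map_one_left := fun _ => rfl }
  obtain ⟨y, hy⟩ := (hnull j).comp_right k
  exact ⟨y, (ContinuousMap.Homotopic.comp ⟨H⟩ (.refl (σ j))).trans hy⟩

/-- Homotopy version of Proposition 7.3: a minimizer of `H^d` in the homotopy Reifenberg
class associated to a closed set `Γ` with `H^d(Γ) = 0` and a family of maps
`σ j : S^{d-1} → Γ` is a sliding minimal set of dimension `d` with the single boundary
piece `Γ`: for every closed ball `B = B̄(x,r)` and every sliding deformation
`(φ_t)_{0 ≤ t ≤ 1}` of `E` in `B`, `H^d(E ∩ B) ≤ H^d(φ₁(E) ∩ B)`. -/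
theorem reifenberg_homotopy_minimizer_is_sliding_minimal
    {n d : ℕ} (hd : 1 ≤ d) (hdn : d < n)
    (Γ : Set (Euc n)) (hΓclosed : IsClosed Γ) (hΓnull : μH[(d : ℝ)] Γ = 0)
    {J : Type*} (σ : J → C(↥(sphere (0 : EuclideanSpace ℝ (Fin d)) 1), ↥Γ))
    (E : Set (Euc n)) (hE : ReifenbergClass Γ σ E)
    (hfin : μH[(d : ℝ)] E < ⊤)
    (hmin : ∀ F, ReifenbergClass Γ σ F → μH[(d : ℝ)] E ≤ μH[(d : ℝ)] F) :
    ∀ (x : Euc n) (r : ℝ), 0 < r →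
      ∀ φ : ℝ → Euc n → Euc n,
        ContinuousOn (fun p : ℝ × Euc n => φ p.1 p.2) (Icc (0 : ℝ) 1 ×ˢ E) →
        (∀ y ∈ E, φ 0 y = y) →
        (∀ t ∈ Icc (0 : ℝ) 1, ∀ y ∈ E ∩ Γ, φ t y ∈ Γ) →
        (∃ K : NNReal, LipschitzOnWith K (φ 1) E) →
        (∀ t ∈ Icc (0 : ℝ) 1,
          (∀ y ∈ E \ closedBall x r, φ t y = y) ∧
          φ t '' (E ∩ closedBall x r) ⊆ closedBall x r) →
        μH[(d : ℝ)] (E ∩ closedBall x r) ≤ μH[(d : ℝ)] ((φ 1 '' E) ∩ closedBall x r) := by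
  intro x r _ φ hφ h0 hΓ _ hB
  have h1 : (1 : ℝ) ∈ Icc (0 : ℝ) 1 := right_mem_Icc.2 zero_le_one
  obtain ⟨hid, himg⟩ := hB 1 h1
  have hcont : ContinuousOn (φ 1) E :=
    hφ.comp (f := fun y => ((1 : ℝ), y)) (by fun_prop) fun y hy => ⟨h1, hy⟩
  have hclosed : IsClosed (φ 1 '' E) :=
    hE.1.image_of_eqOn_id_diff (isCompact_closedBall x r) hcont hid
  have hdiff : φ 1 '' E \ closedBall x r ⊆ E \ closedBall x r := by
    rintro _ ⟨⟨y, hy, rfl⟩, hyB⟩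
    have hy' : y ∉ closedBall x r := fun h => hyB (himg ⟨y, ⟨hy, h⟩, rfl⟩)
    rw [hid y ⟨hy, hy'⟩]
    exact ⟨hy, hy'⟩
  have hle : μH[(d : ℝ)] E ≤ μH[(d : ℝ)] (φ 1 '' E) :=
    (hmin _ (hE.image_union hφ h0 hΓ (hclosed.union hΓclosed))).trans
      ((measure_union_le _ _).trans_eq (by rw [hΓnull, add_zero]))
  have hfin' : μH[(d : ℝ)] (E \ closedBall x r) ≠ ⊤ :=
    ((measure_mono sdiff_subset).trans_lt hfin).ne
  refine (ENNReal.add_le_add_iff_right hfin').1 ?_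
  calc μH[(d : ℝ)] (E ∩ closedBall x r) + μH[(d : ℝ)] (E \ closedBall x r)
      = μH[(d : ℝ)] E := measure_inter_add_sdiff E measurableSet_closedBall
    _ ≤ μH[(d : ℝ)] (φ 1 '' E) := hle
    _ = μH[(d : ℝ)] (φ 1 '' E ∩ closedBall x r) + μH[(d : ℝ)] (φ 1 '' E \ closedBall x r) :=
      (measure_inter_add_sdiff _ measurableSet_closedBall).symm
    _ ≤ μH[(d : ℝ)] (φ 1 '' E ∩ closedBall x r) + μH[(d : ℝ)] (E \ closedBall x r) := by
      gcongr
end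
end

section
/- Sliding minimizers are Almgren minimal away from the topological boundaries of the boundary pieces. Let Γ₁,…,Γ_m ⊂ ℝⁿ be closed boundary pieces and E₀ ⊂ ℝⁿ a compact set. Suppose E ∈ 𝓕(E₀) satisfies H^d(E) = inf_{F∈𝓕(E₀)} H^d(F) < +∞. Then for every closed ball B ⊂ ℝⁿ ∖ ⋃_j ∂Γ_j (where ∂Γ_j is the topological boundary of Γ_j) and every Lipschitz map φ : ℝⁿ → ℝⁿ with φ(x) = x for x ∈ ℝⁿ ∖ B and φ(B) ⊂ B, one has H^d(E ∩ B) ≤ H^d(φ(E) ∩ B). -/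
open MeasureTheory Metric Set

noncomputable section

/-- The class `𝓕(E₀)` of sliding deformations of `E₀` with respect to the closed boundary
pieces `Γ j`. -/
def SlidingClass {n m : ℕ} (Γ : Fin m → Set (Euc n)) (E₀ : Set (Euc n))
    (F : Set (Euc n)) : Prop :=
  ∃ φ : ℝ → Euc n → Euc n,
    ContinuousOn (fun p : ℝ × Euc n => φ p.1 p.2) (Icc (0 : ℝ) 1 ×ˢ E₀) ∧
    (∀ x ∈ E₀, φ 0 x = x) ∧
    (∀ j : Fin m, ∀ t ∈ Icc (0 : ℝ) 1, ∀ x ∈ E₀ ∩ Γ j, φ t x ∈ Γ j) ∧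
    (∃ K : NNReal, LipschitzOnWith K (φ 1) E₀) ∧
    F = φ 1 '' E₀

/-- A preconnected set which avoids the frontier of `s` and meets `s` is contained in `s`. -/
theorem subset_of_isPreconnected_of_disjoint_frontier {X : Type*} [TopologicalSpace X]
    {s t : Set X} (ht : IsPreconnected t) (hts : Disjoint t (frontier s)) (h : (t ∩ s).Nonempty) :
    t ⊆ s := by
  have hcover : t ⊆ interior s ∪ interior sᶜ := by
    rw [← compl_frontier_eq_union_interior]
    exact hts.subset_compl_right
  obtain ⟨y, hyt, hys⟩ := h
  have hy : y ∈ interior s :=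
    (hcover hyt).resolve_right fun hyc => interior_subset hyc hys
  exact (ht.subset_left_of_subset_union isOpen_interior isOpen_interior
    (disjoint_compl_right.mono interior_subset interior_subset) hcover ⟨y, hyt, hy⟩).trans
    interior_subset

/-- Post-composing a sliding deformation with a Lipschitz map which is the identity outside a
convex set `B` avoiding the frontiers of the boundary pieces, and maps `B` into itself, gives
a sliding deformation. -/
theorem SlidingClass.image {n m : ℕ} {Γ : Fin m → Set (Euc n)} {E₀ E B : Set (Euc n)}
    (hE : SlidingClass Γ E₀ E) (hconv : Convex ℝ B) (hB : B ⊆ (⋃ j, frontier (Γ j))ᶜ)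
    {φ : Euc n → Euc n} {K : NNReal} (hφlip : LipschitzWith K φ)
    (hφid : ∀ y ∉ B, φ y = y) (hφB : MapsTo φ B B) :
    SlidingClass Γ E₀ (φ '' E) := by
  obtain ⟨ψ, hcont, hzero, hΓ, ⟨L, hL⟩, rfl⟩ := hE
  refine ⟨fun t x => AffineMap.lineMap (ψ t x) (φ (ψ t x)) t, ?_, ?_, ?_, ⟨K * L, ?_⟩, ?_⟩
  · simp only [AffineMap.lineMap_apply_module]
    exact ((continuousOn_const.sub continuousOn_fst).smul hcont).add
      (continuousOn_fst.smul (hφlip.continuous.comp_continuousOn hcont))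
  · intro x hx
    simp [hzero x hx]
  · intro j t ht x hx
    have hy := hΓ j t ht x hx
    by_cases hyB : ψ t x ∈ B
    · have hdisj : Disjoint B (frontier (Γ j)) :=
        disjoint_left.mpr fun z hz hzf => hB hz (mem_iUnion.mpr ⟨j, hzf⟩)
      exact subset_of_isPreconnected_of_disjoint_frontier hconv.isPreconnected hdisj
        ⟨_, hyB, hy⟩ (hconv.lineMap_mem hyB (hφB hyB) ht)
    · simpa [hφid _ hyB] using hy
  · simpa [Function.comp_def] using hφlip.comp_lipschitzOnWith hL
  · simp [image_image]

/-- A minimizer of the sliding Plateau problem is Almgren minimal away from the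
topological boundaries of the boundary pieces: for every closed ball `B` avoiding
`⋃ j ∂Γ j` and every Lipschitz map of `ℝⁿ` equal to the identity outside `B` and
mapping `B` into itself, `H^d(E ∩ B) ≤ H^d(φ(E) ∩ B)`. -/
theorem sliding_minimizer_almgren_minimal_away_from_boundary
    {n m d : ℕ} (Γ : Fin m → Set (Euc n)) (hΓ : ∀ j, IsClosed (Γ j))
    (E₀ : Set (Euc n)) (hE₀ : IsCompact E₀)
    (E : Set (Euc n)) (hE : SlidingClass Γ E₀ E)
    (hfin : μH[(d : ℝ)] E < ⊤)
    (hmin : ∀ F, SlidingClass Γ E₀ F → μH[(d : ℝ)] E ≤ μH[(d : ℝ)] F)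
    (x : Euc n) (r : ℝ) (hr : 0 < r)
    (hB : closedBall x r ⊆ (⋃ j, frontier (Γ j))ᶜ)
    (φ : Euc n → Euc n) (hφlip : ∃ K : NNReal, LipschitzWith K φ)
    (hφid : ∀ y ∉ closedBall x r, φ y = y)
    (hφB : φ '' closedBall x r ⊆ closedBall x r) :
    μH[(d : ℝ)] (E ∩ closedBall x r) ≤ μH[(d : ℝ)] ((φ '' E) ∩ closedBall x r) := by
  obtain ⟨K, hK⟩ := hφlip
  set B := closedBall x r
  have hmeas : MeasurableSet B := isClosed_closedBall.measurableSet
  have hle := hmin _ (hE.image (convex_closedBall x r) hB hK hφid (mapsTo_iff_image_subset.mpr hφB))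
  have hdiff : φ '' E \ B ⊆ E \ B := by
    rintro _ ⟨⟨y, hy, rfl⟩, hyB⟩
    have hy' : y ∉ B := fun h => hyB (hφB (mem_image_of_mem φ h))
    rw [hφid y hy']
    exact ⟨hy, hy'⟩
  have hfin' : μH[(d : ℝ)] (E \ B) ≠ ⊤ := measure_ne_top_of_subset sdiff_subset hfin.ne
  refine (ENNReal.add_le_add_iff_right hfin').mp ?_
  calc μH[(d : ℝ)] (E ∩ B) + μH[(d : ℝ)] (E \ B) = μH[(d : ℝ)] E :=
        measure_inter_add_sdiff E hmeas
    _ ≤ μH[(d : ℝ)] (φ '' E) := hle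
    _ = μH[(d : ℝ)] (φ '' E ∩ B) + μH[(d : ℝ)] (φ '' E \ B) :=
        (measure_inter_add_sdiff _ hmeas).symm
    _ ≤ μH[(d : ℝ)] (φ '' E ∩ B) + μH[(d : ℝ)] (E \ B) := by gcongr
end
end

section
/- Sliding almost minimal sets are Almgren almost minimal away from the topological boundaries of the boundary pieces. Let Γ₁,…,Γ_m ⊂ ℝⁿ be closed boundary pieces, let h : (0,∞) → [0,∞) be a nondecreasing gauge function, and let E ⊂ ℝⁿ be a closed set with H^d(E) < +∞ such that, for every closed ball B = B̄(x,r) ⊂ ℝⁿ and every sliding deformation (φ_t)_{0≤t≤1} of E in B, H^d(E ∩ B) ≤ H^d(φ₁(E) ∩ B) + r^d h(r). Then for every closed ball B̄(x,r) ⊂ ℝⁿ ∖ ⋃_j ∂Γ_j (∂Γ_j the topological boundary of Γ_j) and every Lipschitz map φ : ℝⁿ → ℝⁿ with φ(y) = y for y ∈ ℝⁿ ∖ B̄(x,r) and φ(B̄(x,r)) ⊂ B̄(x,r), one has H^d(E ∩ B̄(x,r)) ≤ H^d(φ(E) ∩ B̄(x,r)) + r^d h(r). -/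
open MeasureTheory Metric Set

noncomputable section

/-- A closed ball that avoids the frontier of a set `s` and meets `s` is contained in `s`. -/
theorem closedBall_subset_of_disjoint_frontier {V : Type*} [SeminormedAddCommGroup V]
    [NormedSpace ℝ V] {s : Set V} {x : V} {r : ℝ} (hB : closedBall x r ⊆ (frontier s)ᶜ)
    (hne : (closedBall x r ∩ s).Nonempty) : closedBall x r ⊆ s := by
  by_contra hns
  obtain ⟨z, hz, hzs⟩ := not_subset.1 hns
  obtain ⟨w, -, hwi, hwc⟩ := (convex_closedBall x r).isPreconnected (interior s) (closure s)ᶜ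
    isOpen_interior isClosed_closure.isOpen_compl
    (fun y hy => by
      by_contra hyn
      simp only [mem_union, mem_compl_iff, not_or, not_not] at hyn
      exact hB hy ⟨hyn.2, hyn.1⟩)
    (hne.imp fun y hy => ⟨hy.1, by_contra fun hyi => hB hy.1 ⟨subset_closure hy.2, hyi⟩⟩)
    ⟨z, hz, fun hzc => hB hz ⟨hzc, fun hzi => hzs (interior_subset hzi)⟩⟩
  exact hwc (interior_subset_closure hwi)

/-- Sliding almost minimal sets are Almgren almost minimal away from the topological
boundaries of the boundary pieces: if the closed set `E`, with `H^d(E) < ∞`, satisfies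
`H^d(E ∩ B) ≤ H^d(φ₁(E) ∩ B) + r^d h(r)` for every closed ball `B = B̄(x,r)` and every
sliding deformation `(φ_t)` of `E` in `B` (with respect to the closed boundary pieces
`Γ j`), then for every closed ball `B̄(x,r)` avoiding `⋃ j ∂Γ j` and every Lipschitz map
`φ : ℝⁿ → ℝⁿ` equal to the identity outside `B̄(x,r)` and mapping `B̄(x,r)` into itself,
one has `H^d(E ∩ B̄(x,r)) ≤ H^d(φ(E) ∩ B̄(x,r)) + r^d h(r)`. -/
theorem sliding_almost_minimal_is_almgren_almost_minimal_away_from_boundary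
    {n m d : ℕ} (Γ : Fin m → Set (Euc n)) (hΓ : ∀ j, IsClosed (Γ j))
    (h : ℝ → ℝ) (hh0 : ∀ r : ℝ, 0 < r → 0 ≤ h r)
    (hhmono : ∀ r s : ℝ, 0 < r → r ≤ s → h r ≤ h s)
    (E : Set (Euc n)) (hEclosed : IsClosed E) (hfin : μH[(d : ℝ)] E < ⊤)
    (halm : ∀ (x : Euc n) (r : ℝ), 0 < r →
      ∀ φ : ℝ → Euc n → Euc n,
        ContinuousOn (fun p : ℝ × Euc n => φ p.1 p.2) (Icc (0 : ℝ) 1 ×ˢ E) →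
        (∀ y ∈ E, φ 0 y = y) →
        (∀ j : Fin m, ∀ t ∈ Icc (0 : ℝ) 1, ∀ y ∈ E ∩ Γ j, φ t y ∈ Γ j) →
        (∃ K : NNReal, LipschitzOnWith K (φ 1) E) →
        (∀ t ∈ Icc (0 : ℝ) 1,
          (∀ y ∈ E \ closedBall x r, φ t y = y) ∧
          φ t '' (E ∩ closedBall x r) ⊆ closedBall x r) →
        μH[(d : ℝ)] (E ∩ closedBall x r) ≤
          μH[(d : ℝ)] ((φ 1 '' E) ∩ closedBall x r) + ENNReal.ofReal (r ^ d * h r))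
    (x : Euc n) (r : ℝ) (hr : 0 < r)
    (hB : closedBall x r ⊆ (⋃ j, frontier (Γ j))ᶜ)
    (φ : Euc n → Euc n) (hφlip : ∃ K : NNReal, LipschitzWith K φ)
    (hφid : ∀ y ∉ closedBall x r, φ y = y)
    (hφB : φ '' closedBall x r ⊆ closedBall x r) :
    μH[(d : ℝ)] (E ∩ closedBall x r) ≤
      μH[(d : ℝ)] ((φ '' E) ∩ closedBall x r) + ENNReal.ofReal (r ^ d * h r) := by
  have hφB' : ∀ y ∈ closedBall x r, φ y ∈ closedBall x r :=
    fun y hy => hφB (mem_image_of_mem φ hy)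
  have hfix : ∀ t : ℝ, ∀ y ∉ closedBall x r, AffineMap.lineMap y (φ y) t = y := by
    intro t y hy
    rw [hφid y hy, AffineMap.lineMap_same_apply]
  have hstay : ∀ t ∈ Icc (0 : ℝ) 1, ∀ y ∈ closedBall x r,
      AffineMap.lineMap y (φ y) t ∈ closedBall x r :=
    fun t ht y hy => (convex_closedBall x r).lineMap_mem hy (hφB' y hy) ht
  obtain ⟨K, hK⟩ := hφlip
  have hcont := hK.continuous
  have key := halm x r hr (fun t y => AffineMap.lineMap y (φ y) t) ?_ ?_ ?_ ?_ ?_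
  · simpa only [AffineMap.lineMap_apply_one] using key
  · simp only [AffineMap.lineMap_apply_module]
    exact Continuous.continuousOn (by fun_prop)
  · intro y _
    exact AffineMap.lineMap_apply_zero _ _
  · rintro j t ht y ⟨-, hyΓ⟩
    by_cases hy : y ∈ closedBall x r
    · exact closedBall_subset_of_disjoint_frontier
        (hB.trans (compl_subset_compl.2 (subset_iUnion (fun j => frontier (Γ j)) j)))
        ⟨y, hy, hyΓ⟩ (hstay t ht y hy)
    · simpa only [hfix t y hy] using hyΓ
  · exact ⟨K, by simpa only [AffineMap.lineMap_apply_one] using hK.lipschitzOnWith⟩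
  · refine fun t ht => ⟨fun y hy => hfix t y hy.2, ?_⟩
    rintro _ ⟨y, hy, rfl⟩
    exact hstay t ht y hy.2
end
end

section
/- Negligibility of the residual set in the closure of the Borel support (claim (7.13)). Let A ⊂ ℝⁿ be a Borel set with H^d(A) < +∞, let E be the closure of A, and let Z ⊂ ℝⁿ be a closed set. Assume there is a constant c > 0 such that H^d(A ∩ B(x,r)) ≥ c·r^d for every x ∈ E ∖ Z and every 0 < r < dist(x,Z), where B(x,r) is the open ball. Then H^d(E ∖ (Z ∪ A)) = 0. -/
open MeasureTheory Metric Set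

noncomputable section

open scoped Topology ENNReal

/-- A measure with lower `d`-density at least `c` on `s` controls the `d`-dimensional Hausdorff
measure of `s` on open neighbourhoods of `s`. -/
theorem hausdorffMeasure_le_mul_of_subset_isOpen {X : Type*} [MetricSpace X]
    [MeasurableSpace X] [BorelSpace X] [TopologicalSpace.SeparableSpace X] {μ : Measure X}
    {d c : ℝ} (hd : 0 ≤ d) (hc : 0 < c) {s U : Set X} (hU : IsOpen U) (hsU : s ⊆ U)
    (hs : ∀ x ∈ s, ∀ᶠ r in 𝓝[>] (0 : ℝ), ENNReal.ofReal (c * r ^ d) ≤ μ (ball x r)) :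
    μH[d] s ≤ ENNReal.ofReal (8 ^ d / c) * μ U := by
  have radius : ∀ (m : ℕ) (x : s), ∃ r : ℝ, 0 < r ∧ r ≤ 1 / ((m : ℝ) + 1) ∧ ball (x : X) r ⊆ U ∧
      ENNReal.ofReal (c * r ^ d) ≤ μ (ball (x : X) r) := by
    intro m x
    obtain ⟨ε, hε, hεU⟩ := Metric.isOpen_iff.1 hU x (hsU x.2)
    have hm : (0 : ℝ) < 1 / ((m : ℝ) + 1) := by positivity
    have h : ∀ᶠ r in 𝓝[>] (0 : ℝ), r ∈ Ioo 0 (min ε (1 / ((m : ℝ) + 1))) :=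
      Ioo_mem_nhdsGT (lt_min hε hm)
    obtain ⟨r, hr, hrm⟩ := ((hs x x.2).and h).exists
    exact ⟨r, hrm.1, (hrm.2.trans_le (min_le_right _ _)).le,
      (ball_subset_ball (hrm.2.trans_le (min_le_left _ _)).le).trans hεU, hr⟩
  choose r hr0 hrm hrU hrμ using radius
  have vitali := fun m : ℕ ↦ Vitali.exists_disjoint_subfamily_covering_enlargement_ball
    (univ : Set s) (fun x ↦ (x : X)) (r m) _ (fun x _ ↦ hrm m x) 4 (by norm_num)
  choose u _ hdisj hcover using vitali
  have hcount : ∀ m, Countable (u m) := fun m ↦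
    ((hdisj m).countable_of_isOpen (fun _ _ ↦ isOpen_ball)
      (fun x _ ↦ nonempty_ball.2 (hr0 m x))).to_subtype
  have hdiam : ∀ m (x : s), ediam (ball (x : X) (4 * r m x)) ≤ ENNReal.ofReal (8 * r m x) := by
    intro m x
    refine ediam_le_of_forall_dist_le fun y hy z hz ↦ ?_
    have := dist_triangle_right y z (x : X)
    rw [mem_ball] at hy hz
    linarith
  have hlim : Filter.Tendsto (fun m : ℕ ↦ ENNReal.ofReal (8 * (1 / ((m : ℝ) + 1))))
      Filter.atTop (𝓝 0) := by
    simpa using ENNReal.tendsto_ofReal (tendsto_one_div_add_atTop_nhds_zero_nat.const_mul (8 : ℝ))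
  refine (Measure.hausdorffMeasure_le_liminf_tsum d s _ hlim
    (fun m (x : u m) ↦ ball (x : X) (4 * r m x)) (.of_forall fun m x ↦ ?_)
    (.of_forall fun m x hx ↦ ?_)).trans ?_
  · exact (hdiam m x).trans (ENNReal.ofReal_le_ofReal (by gcongr; exact hrm m x))
  · obtain ⟨b, hb, hsub⟩ := hcover m ⟨x, hx⟩ (mem_univ _)
    exact mem_iUnion.2 ⟨⟨b, hb⟩, hsub (mem_ball_self (hr0 m _))⟩
  · refine Filter.liminf_le_of_le (by isBoundedDefault) fun b hb ↦ ?_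
    obtain ⟨m, hm⟩ := hb.exists
    refine hm.trans ?_
    have hterm : ∀ x : u m, ediam (ball (x : X) (4 * r m x)) ^ d ≤
        ENNReal.ofReal (8 ^ d / c) * μ (ball (x : X) (r m x)) := by
      intro x
      have hr := hr0 m x
      calc ediam (ball (x : X) (4 * r m x)) ^ d
          ≤ ENNReal.ofReal (8 * r m x) ^ d := ENNReal.rpow_le_rpow (hdiam m x) hd
        _ = ENNReal.ofReal (8 ^ d / c) * ENNReal.ofReal (c * r m x ^ d) := by
          rw [ENNReal.ofReal_rpow_of_nonneg (by positivity) hd,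
            ← ENNReal.ofReal_mul (by positivity), Real.mul_rpow (by norm_num) hr.le]
          congr 1
          field_simp
        _ ≤ _ := by gcongr; exact hrμ m x
    calc ∑' x : u m, ediam (ball (x : X) (4 * r m x)) ^ d
        ≤ ∑' x : u m, ENNReal.ofReal (8 ^ d / c) * μ (ball (x : X) (r m x)) :=
          ENNReal.tsum_le_tsum hterm
      _ = ENNReal.ofReal (8 ^ d / c) * ∑' x : u m, μ (ball (x : X) (r m x)) := ENNReal.tsum_mul_left
      _ ≤ ENNReal.ofReal (8 ^ d / c) * μ U := by
        gcongr
        refine (tsum_meas_le_meas_iUnion_of_disjoint μ (fun _ ↦ measurableSet_ball)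
          ((hdisj m).subtype _ _)).trans (measure_mono (iUnion_subset fun x ↦ hrU m x))

/-- A null set of positive lower `d`-density for an outer regular measure is negligible for the
`d`-dimensional Hausdorff measure. -/
theorem hausdorffMeasure_eq_zero_of_measure_eq_zero {X : Type*} [MetricSpace X]
    [MeasurableSpace X] [BorelSpace X] [TopologicalSpace.SeparableSpace X] {μ : Measure X}
    [μ.OuterRegular] {d c : ℝ} (hd : 0 ≤ d) (hc : 0 < c) {s : Set X} (hμs : μ s = 0)
    (hs : ∀ x ∈ s, ∀ᶠ r in 𝓝[>] (0 : ℝ), ENNReal.ofReal (c * r ^ d) ≤ μ (ball x r)) :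
    μH[d] s = 0 := by
  have hle : μH[d] s ≤ ENNReal.ofReal (8 ^ d / c) * μ s := by
    rw [s.measure_eq_iInf_isOpen μ]
    have hC : ENNReal.ofReal (8 ^ d / c) ≠ 0 := (ENNReal.ofReal_pos.2 (by positivity)).ne'
    simp only [ENNReal.mul_iInf_of_ne hC ENNReal.ofReal_ne_top, le_iInf_iff]
    exact fun U hsU hU ↦ hausdorffMeasure_le_mul_of_subset_isOpen hd hc hU hsU hs
  simpa [hμs] using hle

/-- Negligibility of the residual set in the closure of the Borel support (claim (7.13)):
if `A` is a Borel set with `H^d(A) < ∞`, `E = closure A`, `Z` is closed, and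
`H^d(A ∩ B(x,r)) ≥ c·r^d` for every `x ∈ E ∖ Z` and `0 < r < dist(x,Z)` (with
`dist(x,Z) = +∞` when `Z = ∅`), then `H^d(E ∖ (Z ∪ A)) = 0`. -/
theorem residual_set_negligible
    {n : ℕ} (d : ℝ) (hd : 0 < d)
    (A : Set (Euc n)) (hA : MeasurableSet A) (hAfin : μH[d] A < ⊤)
    (Z : Set (Euc n)) (hZ : IsClosed Z)
    (c : ℝ) (hc : 0 < c)
    (hdens : ∀ x ∈ closure A \ Z, ∀ r : ℝ, 0 < r →
      ENNReal.ofReal r < EMetric.infEdist x Z →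
      ENNReal.ofReal (c * r ^ d) ≤ μH[d] (A ∩ ball x r)) :
    μH[d] (closure A \ (Z ∪ A)) = 0 := by
  have : IsFiniteMeasure (μH[d].restrict A) := isFiniteMeasure_restrict.2 hAfin.ne
  refine hausdorffMeasure_eq_zero_of_measure_eq_zero (μ := μH[d].restrict A) hd.le hc ?_ ?_
  · rw [Measure.restrict_apply' hA]
    convert measure_empty (μ := μH[d])
    grind
  · rintro x ⟨hxA, hx⟩
    have hxZ : x ∉ Z := fun h ↦ hx (.inl h)
    have hpos : 0 < Metric.infEDist x Z := by
      refine pos_iff_ne_zero.2 fun h ↦ hxZ ?_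
      rwa [← hZ.closure_eq, Metric.mem_closure_iff_infEDist_zero]
    have hsmall : ∀ᶠ r in 𝓝[>] (0 : ℝ), ENNReal.ofReal r < Metric.infEDist x Z := by
      refine nhdsWithin_le_nhds ((ENNReal.continuous_ofReal.tendsto 0).eventually_lt_const ?_)
      simpa using hpos
    filter_upwards [hsmall, self_mem_nhdsWithin] with r hr hr0
    rw [Measure.restrict_apply' hA, inter_comm]
    exact hdens x ⟨hxA, hxZ⟩ r hr0 hr
end
end

section
/- Lipschitz homotopy through a Lipschitz neighborhood retract. Let Γ ⊂ ℝⁿ be a compact set which is a Lipschitz neighborhood retract: there exist an open set W ⊃ Γ and a Lipschitz map h : W → Γ with h(x) = x for x ∈ Γ. Let Z ⊂ Γ be a compact set and let H : [0,1] × Z → Γ be a continuous map with H(0,x) = x for all x ∈ Z and such that x ↦ H(1,x) is Lipschitz on Z. Then there exists a Lipschitz map ξ : [0,1] × Z → Γ with ξ(0,x) = x and ξ(1,x) = H(1,x) for all x ∈ Z. -/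
open MeasureTheory Metric Set

noncomputable section

/-- A continuous map on a closed set can be uniformly approximated there by the restriction of a
`C¹` map defined on the whole space. -/
theorem exists_contDiff_dist_lt_of_isClosed {E F : Type*}
    [NormedAddCommGroup E] [NormedSpace ℝ E] [FiniteDimensional ℝ E]
    [NormedAddCommGroup F] [NormedSpace ℝ F] [FiniteDimensional ℝ F]
    {s : Set E} (hs : IsClosed s) {f : E → F} (hf : ContinuousOn f s) {ε : ℝ} (hε : 0 < ε) :
    ∃ g : E → F, ContDiff ℝ 1 g ∧ ∀ x ∈ s, dist (g x) (f x) < ε := by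
  have : TietzeExtension F := .of_tvs ℝ
  obtain ⟨f', hf'⟩ := ContinuousMap.exists_restrict_eq hs ⟨s.domRestrict f, hf.domRestrict⟩
  obtain ⟨g, hg, hgf, -⟩ := f'.continuous.exists_contDiff_approx 1
    (continuous_const (y := ε)) fun _ => hε
  refine ⟨g, mod_cast hg, fun x hx => ?_⟩
  have : f' x = f x := DFunLike.congr_fun hf' (⟨x, hx⟩ : s)
  exact this ▸ hgf x

/-- Lipschitz homotopy through a Lipschitz neighborhood retract: let `Γ ⊆ ℝⁿ` be compact,
`W ⊇ Γ` open, and `h : W → Γ` a Lipschitz retraction (`h` Lipschitz on `W`, with values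
in `Γ`, fixing `Γ` pointwise). If `Z ⊆ Γ` is compact and `H : [0,1] × Z → Γ` is a
continuous homotopy with `H(0,·) = id` and `H(1,·)` Lipschitz on `Z`, then there is a
Lipschitz map `ξ : [0,1] × Z → Γ` with `ξ(0,·) = id` and `ξ(1,·) = H(1,·)` on `Z`. -/
theorem lipschitz_homotopy_through_retract
    {n : ℕ} (Γ : Set (Euc n)) (hΓ : IsCompact Γ)
    (W : Set (Euc n)) (hW : IsOpen W) (hΓW : Γ ⊆ W)
    (h : Euc n → Euc n) (hhlip : ∃ K : NNReal, LipschitzOnWith K h W)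
    (hhΓ : ∀ x ∈ W, h x ∈ Γ) (hhid : ∀ x ∈ Γ, h x = x)
    (Z : Set (Euc n)) (hZcomp : IsCompact Z) (hZΓ : Z ⊆ Γ)
    (H : ℝ → Euc n → Euc n)
    (hHcont : ContinuousOn (fun p : ℝ × Euc n => H p.1 p.2) (Icc (0 : ℝ) 1 ×ˢ Z))
    (hHΓ : ∀ t ∈ Icc (0 : ℝ) 1, ∀ x ∈ Z, H t x ∈ Γ)
    (hH0 : ∀ x ∈ Z, H 0 x = x)
    (hH1lip : ∃ K : NNReal, LipschitzOnWith K (H 1) Z) :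
    ∃ ξ : ℝ → Euc n → Euc n,
      (∃ K : NNReal,
        LipschitzOnWith K (fun p : ℝ × Euc n => ξ p.1 p.2) (Icc (0 : ℝ) 1 ×ˢ Z)) ∧
      (∀ t ∈ Icc (0 : ℝ) 1, ∀ x ∈ Z, ξ t x ∈ Γ) ∧
      (∀ x ∈ Z, ξ 0 x = x) ∧
      (∀ x ∈ Z, ξ 1 x = H 1 x) := by
  obtain ⟨K, hK⟩ := hhlip
  obtain ⟨L, hL⟩ := hH1lip
  obtain ⟨g, ⟨M, hg⟩, hgH⟩ : ∃ g : Euc n → Euc n, (∃ M, LipschitzWith M g) ∧ EqOn (H 1) g Z := by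
    obtain ⟨g, hg, hgH⟩ := hL.extend_finite_dimension
    exact ⟨g, ⟨_, hg⟩, hgH⟩
  obtain ⟨δ, hδ, hδW⟩ := hΓ.exists_thickening_subset_open hW hΓW
  have hcomp : IsCompact (Icc (0 : ℝ) 1 ×ˢ Z) := isCompact_Icc.prod hZcomp
  obtain ⟨F, hF, hFH⟩ := exists_contDiff_dist_lt_of_isClosed hcomp.isClosed hHcont (half_pos hδ)
  let G : ℝ × Euc n → Euc n := fun p =>
    F p + (1 - p.1) • (p.2 - F (0, p.2)) + p.1 • (g p.2 - F (1, p.2))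
  have hG : LocallyLipschitz G := by
    let Φ : (ℝ × Euc n) × Euc n → Euc n := fun q =>
      F q.1 + (1 - q.1.1) • (q.1.2 - F (0, q.1.2)) + q.1.1 • (q.2 - F (1, q.1.2))
    have hΦ : ContDiff ℝ 1 Φ := by fun_prop
    have hpair : LocallyLipschitz fun p : ℝ × Euc n => (p, g p.2) :=
      LocallyLipschitz.id.prodMk (hg.comp LipschitzWith.prod_snd).locallyLipschitz
    have hΦL : LocallyLipschitz Φ := hΦ.locallyLipschitz (𝕂 := ℝ)
    have hcp : LocallyLipschitz (Φ ∘ fun p : ℝ × Euc n => (p, g p.2)) := hΦL.comp hpair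
    exact hcp
  have hGH : ∀ t ∈ Icc (0 : ℝ) 1, ∀ x ∈ Z, dist (G (t, x)) (H t x) < δ := by
    intro t ht x hx
    have h0 := hFH (0, x) ⟨by simp, hx⟩
    have h1 := hFH (1, x) ⟨by simp, hx⟩
    have h2 := hFH (t, x) ⟨ht, hx⟩
    simp only [hH0 x hx, hgH hx] at h0 h1
    have hcorr : ‖(1 - t) • (x - F (0, x)) + t • (g x - F (1, x))‖ < δ / 2 := by
      rw [← mem_ball_zero_iff]
      refine convex_ball (0 : Euc n) (δ / 2) ?_ ?_ (sub_nonneg.2 ht.2) ht.1 (by ring)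
      · rwa [mem_ball_zero_iff, ← dist_eq_norm, dist_comm]
      · rwa [mem_ball_zero_iff, ← dist_eq_norm, dist_comm]
    rw [dist_eq_norm] at h2 ⊢
    calc ‖G (t, x) - H t x‖
        = ‖(F (t, x) - H t x) + ((1 - t) • (x - F (0, x)) + t • (g x - F (1, x)))‖ := by
          congr 1
          simp only [G]
          abel
      _ ≤ _ := norm_add_le _ _
      _ < δ := by linarith
  have hGW : MapsTo G (Icc (0 : ℝ) 1 ×ˢ Z) W := fun p hp =>
    hδW (mem_thickening_iff.2 ⟨_, hHΓ p.1 hp.1 p.2 hp.2, hGH p.1 hp.1 p.2 hp.2⟩)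
  obtain ⟨C, hC⟩ := hG.locallyLipschitzOn.exists_lipschitzOnWith_of_compact hcomp
  refine ⟨fun t x => h (G (t, x)), ⟨K * C, hK.comp hC hGW⟩,
    fun t ht x hx => hhΓ _ (hGW ⟨ht, hx⟩), fun x hx => ?_, fun x hx => ?_⟩
  · have : G (0, x) = x := by simp [G]
    simpa only [this] using hhid x (hZΓ hx)
  · have : G (1, x) = H 1 x := by simp [G, hgH hx]
    simpa only [this] using hhid _ (hHΓ 1 (by simp) x hx)
end
end

section
/- Douglas kernel identity (formula (2.2)). Let g : ℝ → ℂ be a continuous 2π-periodic function, and let a_k = (1/2π)∫₀^{2π} g(θ) e^{−ikθ} dθ for k ∈ ℤ be its Fourier coefficients. Then, as an identity in [0, +∞], ∫₀^{2π}∫₀^{2π} |g(θ) − g(φ)|² / sin²((θ − φ)/2) dθ dφ = 16π² · Σ_{k∈ℤ} |k| · |a_k|². -/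
open MeasureTheory Real Set

noncomputable section

theorem lintegral_Ioc_comp_add_left_of_periodic {T : ℝ} (hT : 0 < T) {f : ℝ → ENNReal}
    (hf : Function.Periodic f T) (t : ℝ) :
    ∫⁻ x in Ioc 0 T, f (t + x) = ∫⁻ x in Ioc 0 T, f x := by
  have h1 := (measurePreserving_add_left (volume : Measure ℝ) t).setLIntegral_comp_preimage_emb
    (measurableEmbedding_addLeft t) f (Ioc t (t + T))
  have h2 : (fun x => t + x) ⁻¹' Ioc t (t + T) = Ioc 0 T := by
    ext x; simp
  rw [h2] at h1
  rw [h1]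
  have h3 := isAddFundamentalDomain_Ioc hT 0
  rw [zero_add] at h3
  refine (isAddFundamentalDomain_Ioc hT t).setLIntegral_eq h3 f fun g x => ?_
  obtain ⟨_, n, rfl⟩ := g
  simpa [AddSubgroup.vadd_def, add_comm] using hf.zsmul n x

/-- The Dirichlet kernel `1 + 2 ∑ cos (k x)`, `1 ≤ k ≤ n`. -/
def dirichletKernel (n : ℕ) (x : ℝ) : ℝ :=
  1 + 2 * ∑ k ∈ Finset.range n, cos ((k + 1 : ℕ) * x)

/-- The (unnormalised) Fejér kernel, the sum of the first `n` Dirichlet kernels. -/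
def fejerKernel (n : ℕ) (x : ℝ) : ℝ :=
  ∑ k ∈ Finset.range n, dirichletKernel k x

theorem continuous_dirichletKernel (n : ℕ) : Continuous (dirichletKernel n) := by
  unfold dirichletKernel
  fun_prop

theorem continuous_fejerKernel (n : ℕ) : Continuous (fejerKernel n) :=
  continuous_finsetSum _ fun k _ => continuous_dirichletKernel k

theorem dirichletKernel_mul_sin (n : ℕ) (x : ℝ) :
    dirichletKernel n x * sin (x / 2) = sin (n * x + x / 2) := by
  induction n with
  | zero => simp [dirichletKernel]
  | succ n ih =>
    have h : dirichletKernel (n + 1) x = dirichletKernel n x + 2 * cos ((n + 1 : ℕ) * x) := by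
      simp only [dirichletKernel, Finset.sum_range_succ]; ring
    have e : (n : ℝ) * x + x / 2 = (n + 1 : ℕ) * x - x / 2 := by push_cast; ring
    rw [h, add_mul, ih, e, sin_sub, sin_add]
    ring

theorem fejerKernel_mul_sin_sq (n : ℕ) (x : ℝ) :
    fejerKernel n x * sin (x / 2) ^ 2 = sin (n * x / 2) ^ 2 := by
  induction n with
  | zero => simp [fejerKernel]
  | succ n ih =>
    have h : fejerKernel (n + 1) x = fejerKernel n x + dirichletKernel n x := by
      simp only [fejerKernel, Finset.sum_range_succ]
    have e₁ : (n : ℝ) * x + x / 2 = n * x / 2 + (n * x / 2 + x / 2) := by ring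
    have e₂ : ((n + 1 : ℕ) : ℝ) * x / 2 = n * x / 2 + x / 2 := by push_cast; ring
    rw [h, add_mul, ih, sq (sin (x / 2)), ← mul_assoc, dirichletKernel_mul_sin, e₁, e₂, sin_add,
      sin_add, cos_add]
    have h2 := sin_sq_add_cos_sq (x / 2)
    generalize sin (n * x / 2) = s at *
    generalize cos (n * x / 2) = c at *
    generalize sin (x / 2) = u at *
    generalize cos (x / 2) = v at *
    linear_combination (-s ^ 2) * h2

theorem integral_dirichletKernel (n : ℕ) :
    ∫ x in (0 : ℝ)..(2 * π), dirichletKernel n x = 2 * π := by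
  unfold dirichletKernel
  rw [intervalIntegral.integral_add (by simp) (Continuous.intervalIntegrable (by fun_prop) _ _),
    intervalIntegral.integral_const_mul, intervalIntegral.integral_finsetSum
      (fun k _ => Continuous.intervalIntegrable (by fun_prop) _ _)]
  rw [Finset.sum_eq_zero]
  · simp
  intro k _
  have hk : ((k + 1 : ℕ) : ℝ) ≠ 0 := by positivity
  rw [intervalIntegral.integral_comp_mul_left (fun y => cos y) hk, integral_cos]
  have := sin_nat_mul_pi (2 * (k + 1))
  push_cast at this
  simp only [mul_zero, sin_zero, sub_zero, smul_eq_mul]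
  rw [show ((k + 1 : ℕ) : ℝ) * (2 * π) = 2 * (k + 1) * π by push_cast; ring, this, mul_zero]

theorem integral_fejerKernel (n : ℕ) :
    ∫ x in (0 : ℝ)..(2 * π), fejerKernel n x = n * (2 * π) := by
  unfold fejerKernel
  rw [intervalIntegral.integral_finsetSum
      (fun k _ => (continuous_dirichletKernel k).intervalIntegrable _ _)]
  simp [integral_dirichletKernel]

theorem ae_sin_half_ne_zero : ∀ᵐ x ∂volume.restrict (Ioc 0 (2 * π)), sin (x / 2) ≠ 0 := by
  rw [Measure.restrict_congr_set Ioo_ae_eq_Ioc.symm]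
  filter_upwards [ae_restrict_mem measurableSet_Ioo] with x hx
  exact (sin_pos_of_pos_of_lt_pi (by linarith [hx.1]) (by linarith [hx.2])).ne'

theorem lintegral_sin_sq_div_sin_sq (k : ℤ) :
    ∫⁻ x in Ioc 0 (2 * π), ENNReal.ofReal (sin (k * x / 2) ^ 2 / sin (x / 2) ^ 2)
      = ENNReal.ofReal (2 * π * |(k : ℝ)|) := by
  have hF : ∀ᵐ x ∂volume.restrict (Ioc 0 (2 * π)),
      sin (k * x / 2) ^ 2 / sin (x / 2) ^ 2 = fejerKernel k.natAbs x := by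
    filter_upwards [ae_sin_half_ne_zero] with x hx
    rw [div_eq_iff (pow_ne_zero 2 hx), fejerKernel_mul_sin_sq, Nat.cast_natAbs, Int.cast_abs]
    rcases abs_choice (k : ℝ) with h | h <;> rw [h]
    rw [neg_mul, neg_div, sin_neg, neg_sq]
  rw [lintegral_congr_ae (hF.mono fun x hx => congrArg ENNReal.ofReal hx),
    ← ofReal_integral_eq_lintegral_ofReal, ← intervalIntegral.integral_of_le two_pi_pos.le,
    integral_fejerKernel, Nat.cast_natAbs, Int.cast_abs, mul_comm]
  · exact ((continuous_fejerKernel _).integrableOn_Icc).mono_set Ioc_subset_Icc_self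
  · filter_upwards [hF] with x hx
    rw [← hx]
    positivity

theorem lintegral_norm_sq_add_sub_eq_tsum
    (g : ℝ → ℂ) (hg : Continuous g) (hper : Function.Periodic g (2 * π))
    (a : ℤ → ℂ)
    (ha : ∀ k : ℤ, a k = (1 / (2 * π) : ℝ) •
      ∫ θ in (0 : ℝ)..(2 * π), g θ * Complex.exp (-(k : ℂ) * Complex.I * (θ : ℂ))) (x : ℝ) :
    ∫⁻ θ in Ioc 0 (2 * π), ENNReal.ofReal (‖g (θ + x) - g θ‖ ^ 2) =
      ∑' k : ℤ, ENNReal.ofReal (8 * π * ‖a k‖ ^ 2 * sin (k * x / 2) ^ 2) := by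
  have hcont : Continuous fun θ => g (θ + x) - g θ := by fun_prop
  have hcoeff (k : ℤ) : fourierCoeffOn two_pi_pos (fun θ => g (θ + x) - g θ) k =
      (Complex.exp (Complex.I * (k * x : ℝ)) - 1) * a k := by
    have hshift : ∫ θ in (0 : ℝ)..(2 * π), g (θ + x) * Complex.exp (-(k : ℂ) * Complex.I * θ) =
        Complex.exp (Complex.I * (k * x : ℝ)) *
          ∫ θ in (0 : ℝ)..(2 * π), g θ * Complex.exp (-(k : ℂ) * Complex.I * θ) := by
      have hp : Function.Periodic
          (fun θ : ℝ => g θ * Complex.exp (-(k : ℂ) * Complex.I * θ)) (2 * π) := by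
        intro θ
        have : -(k : ℂ) * Complex.I * ((θ + 2 * π : ℝ) : ℂ) =
            -(k : ℂ) * Complex.I * θ + (-k : ℤ) * (2 * π * Complex.I) := by
          push_cast; ring
        simp only [hper θ]
        rw [this, Complex.exp_add, Complex.exp_int_mul_two_pi_mul_I, mul_one]
      have h := hp.intervalIntegral_add_eq 0 (0 + x)
      rw [add_right_comm 0 x, ← intervalIntegral.integral_comp_add_right, zero_add] at h
      rw [h, ← intervalIntegral.integral_const_mul]
      refine intervalIntegral.integral_congr fun θ _ => ?_
      rw [mul_left_comm, ← Complex.exp_add]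
      congr 2
      push_cast
      ring
    rw [fourierCoeffOn_eq_integral, ha k, sub_zero, mul_smul_comm, sub_mul, one_mul, ← hshift,
      ← intervalIntegral.integral_sub (Continuous.intervalIntegrable (by fun_prop) _ _)
        (Continuous.intervalIntegrable (by fun_prop) _ _)]
    congr 1
    refine intervalIntegral.integral_congr fun θ _ => ?_
    simp only [fourier_coe_apply, smul_eq_mul]
    rw [← sub_mul, mul_comm]
    congr 2
    have : (π : ℂ) ≠ 0 := by exact_mod_cast pi_ne_zero
    push_cast
    field_simp
  have hmem : MemLp (fun θ => g (θ + x) - g θ) 2 (volume.restrict (Ioc 0 (2 * π))) :=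
    (memLp_two_iff_integrable_sq_norm hcont.aestronglyMeasurable).2
      ((Continuous.integrableOn_Icc (by fun_prop)).mono_set Ioc_subset_Icc_self)
  have hsum := (hasSum_sq_fourierCoeffOn two_pi_pos hmem).mul_left (2 * π)
  rw [sub_zero, smul_eq_mul, mul_inv_cancel_left₀ two_pi_pos.ne'] at hsum
  rw [← ofReal_integral_eq_lintegral_ofReal, ← intervalIntegral.integral_of_le two_pi_pos.le]
  · rw [← hsum.tsum_eq, ENNReal.ofReal_tsum_of_nonneg (fun k => by positivity) hsum.summable]
    refine tsum_congr fun k => ?_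
    rw [hcoeff, norm_mul, Complex.norm_exp_I_mul_ofReal_sub_one, mul_pow, norm_eq_abs, sq_abs]
    congr 1
    ring
  · exact (Continuous.integrableOn_Icc (by fun_prop)).mono_set Ioc_subset_Icc_self
  · exact ae_of_all _ fun θ => by positivity

/-- Douglas kernel identity (formula (2.2)): for a continuous `2π`-periodic function
`g : ℝ → ℂ` with Fourier coefficients `a k = (1/2π) ∫₀^{2π} g(θ) e^{-ikθ} dθ`, one has,
as an identity in `[0,∞]`,
`∫₀^{2π}∫₀^{2π} |g(θ)-g(φ)|²/sin²((θ-φ)/2) dθ dφ = 16π² ∑_{k∈ℤ} |k| |a k|²`. -/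
theorem douglas_kernel_identity
    (g : ℝ → ℂ) (hg : Continuous g) (hper : Function.Periodic g (2 * π))
    (a : ℤ → ℂ)
    (ha : ∀ k : ℤ, a k = (1 / (2 * π) : ℝ) •
      ∫ θ in (0 : ℝ)..(2 * π), g θ * Complex.exp (-(k : ℂ) * Complex.I * (θ : ℂ))) :
    (∫⁻ θ in Ioc (0 : ℝ) (2 * π), ∫⁻ φ in Ioc (0 : ℝ) (2 * π),
        ENNReal.ofReal (‖g θ - g φ‖ ^ 2 / Real.sin ((θ - φ) / 2) ^ 2))
      = ENNReal.ofReal (16 * π ^ 2) * ∑' k : ℤ, ENNReal.ofReal (|(k : ℝ)| * ‖a k‖ ^ 2) := by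
  have hgm := hg.measurable
  calc
    _ = ∫⁻ θ in Ioc (0 : ℝ) (2 * π), ∫⁻ x in Ioc (0 : ℝ) (2 * π),
        ENNReal.ofReal (‖g (θ + x) - g θ‖ ^ 2) * ENNReal.ofReal ((sin (x / 2) ^ 2)⁻¹) := by
      refine lintegral_congr fun θ => ?_
      rw [← lintegral_Ioc_comp_add_left_of_periodic two_pi_pos _ θ]
      · refine lintegral_congr fun x => ?_
        rw [← ENNReal.ofReal_mul (by positivity), ← div_eq_mul_inv, norm_sub_rev,
          show (θ - (θ + x)) / 2 = -(x / 2) by ring, sin_neg, neg_sq]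
      · intro φ
        simp only [hper φ]
        rw [show (θ - (φ + 2 * π)) / 2 = (θ - φ) / 2 - π by ring, sin_sub_pi, neg_sq]
    _ = ∫⁻ x in Ioc (0 : ℝ) (2 * π), ∫⁻ θ in Ioc (0 : ℝ) (2 * π),
        ENNReal.ofReal (‖g (θ + x) - g θ‖ ^ 2) * ENNReal.ofReal ((sin (x / 2) ^ 2)⁻¹) :=
      lintegral_lintegral_swap (Measurable.aemeasurable (by unfold Function.uncurry; fun_prop))
    _ = ∫⁻ x in Ioc (0 : ℝ) (2 * π), ∑' k : ℤ, ENNReal.ofReal (8 * π * ‖a k‖ ^ 2) *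
          ENNReal.ofReal (sin (k * x / 2) ^ 2 / sin (x / 2) ^ 2) := by
      refine lintegral_congr fun x => ?_
      rw [lintegral_mul_const _ (by fun_prop), lintegral_norm_sq_add_sub_eq_tsum g hg hper a ha,
        ← ENNReal.tsum_mul_right]
      refine tsum_congr fun k => ?_
      rw [← ENNReal.ofReal_mul (by positivity), ← ENNReal.ofReal_mul (by positivity)]
      congr 1
      ring
    _ = ∑' k : ℤ, ENNReal.ofReal (8 * π * ‖a k‖ ^ 2) * ENNReal.ofReal (2 * π * |(k : ℝ)|) := by
      rw [lintegral_tsum fun k => Measurable.aemeasurable (by fun_prop)]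
      refine tsum_congr fun k => ?_
      rw [lintegral_const_mul _ (by fun_prop), lintegral_sin_sq_div_sin_sq]
    _ = _ := by
      rw [← ENNReal.tsum_mul_left]
      refine tsum_congr fun k => ?_
      rw [← ENNReal.ofReal_mul (by positivity), ← ENNReal.ofReal_mul (by positivity)]
      congr 1
      ring
end
end

section
/- Dirichlet energy of the harmonic extension in terms of the boundary Fourier coefficients. Let (a_k)_{k∈ℤ} be complex numbers with Σ_{k∈ℤ} |a_k| < +∞, and define f on the open unit disc D ⊂ ℂ by f(z) = Σ_{k≥0} a_k z^k + Σ_{k≥1} a_{−k} (z̄)^k, so that f is the harmonic extension of the boundary function θ ↦ Σ_{k∈ℤ} a_k e^{ikθ}. Then, as an identity in [0, +∞], ∫_D (|∂f/∂x|² + |∂f/∂y|²) dA = 2π · Σ_{k∈ℤ} |k| · |a_k|², where dA is planar Lebesgue measure and ∂f/∂x, ∂f/∂y are the partial derivatives of f viewed as a map from ℝ² to ℂ. -/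
open MeasureTheory Real Set

noncomputable section

theorem integral_exp_int_mul_I (k : ℤ) :
    ∫ θ in Ioo (-π) π, Complex.exp (k * θ * Complex.I) = if k = 0 then (2 * π : ℂ) else 0 := by
  rw [← integral_Ioc_eq_integral_Ioo, ← intervalIntegral.integral_of_le (by linarith [pi_pos])]
  split_ifs with h
  · simp [h]
    ring
  · have hc : (k : ℂ) * Complex.I ≠ 0 := by simp [h]
    have := integral_exp_mul_complex (a := -π) (b := π) hc
    simp_rw [mul_right_comm _ Complex.I] at this
    rw [this, div_eq_zero_iff]
    left
    rw [sub_eq_zero, Complex.exp_eq_exp_iff_exists_int]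
    exact ⟨k, by push_cast; ring⟩

theorem lintegral_normSq_tsum_exp {d : ℕ → ℂ} (hd : Summable fun n => ‖d n‖) :
    ∫⁻ θ in Ioo (-π) π, ENNReal.ofReal (‖∑' n : ℕ, d n * Complex.exp (n * θ * Complex.I)‖ ^ 2)
      = ENNReal.ofReal (2 * π) * ∑' n, ENNReal.ofReal (‖d n‖ ^ 2) := by
  have hn (n : ℕ) (θ : ℝ) : ‖d n * Complex.exp (n * θ * Complex.I)‖ = ‖d n‖ := by
    have := Complex.norm_exp_ofReal_mul_I (n * θ)
    push_cast at this
    rw [norm_mul, this, mul_one]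
  have hcont : Continuous fun θ : ℝ => ∑' n : ℕ, d n * Complex.exp (n * θ * Complex.I) :=
    continuous_tsum (fun n => by fun_prop) hd fun n θ => (hn n θ).le
  have hint : IntegrableOn (fun θ : ℝ =>
      ‖∑' n : ℕ, d n * Complex.exp (n * θ * Complex.I)‖ ^ 2) (Ioo (-π) π) :=
    ((hcont.norm.pow 2).integrableOn_Icc (a := -π) (b := π)).mono_set Ioo_subset_Icc_self
  have hd2 : Summable fun n => ‖d n‖ ^ 2 := by
    simpa [sq, Function.comp_def] using (hd.mul_norm hd).comp_injective
      (i := fun n : ℕ => (n, n)) (fun a b h => (Prod.ext_iff.1 h).1)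
  rw [← ofReal_integral_eq_lintegral_ofReal hint (.of_forall fun θ => by positivity),
    ← ENNReal.ofReal_tsum_of_nonneg (fun n => by positivity) hd2,
    ← ENNReal.ofReal_mul (by positivity)]
  congr 1
  rw [← Complex.ofReal_inj, ← integral_complex_ofReal]
  have hexp (m n : ℕ) (θ : ℝ) : d m * Complex.exp (m * θ * Complex.I) *
      starRingEnd ℂ (d n * Complex.exp (n * θ * Complex.I)) =
      d m * starRingEnd ℂ (d n) * Complex.exp (((m - n : ℤ) : ℂ) * θ * Complex.I) := by
    rw [map_mul, ← Complex.exp_conj, mul_mul_mul_comm, ← Complex.exp_add]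
    congr 2
    simp
    ring
  have hprod (θ : ℝ) : ((‖∑' n : ℕ, d n * Complex.exp (n * θ * Complex.I)‖ ^ 2 : ℝ) : ℂ) =
      ∑' p : ℕ × ℕ, d p.1 * starRingEnd ℂ (d p.2) *
        Complex.exp (((p.1 - p.2 : ℤ) : ℂ) * θ * Complex.I) := by
    have hs : Summable fun n : ℕ => ‖d n * Complex.exp (n * θ * Complex.I)‖ := by
      simpa only [hn] using hd
    rw [Complex.ofReal_pow, ← Complex.mul_conj', Complex.conj_tsum,
      tsum_mul_tsum_of_summable_norm hs (by simpa only [RCLike.norm_conj] using hs)]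
    simp only [hexp]
  simp_rw [hprod]
  rw [← integral_tsum_of_summable_integral_norm]
  · simp_rw [integral_const_mul, integral_exp_int_mul_I]
    rw [← Function.Injective.tsum_eq (g := fun n : ℕ => (n, n))
      (fun a b h => (Prod.ext_iff.1 h).1)]
    · rw [Complex.ofReal_mul, Complex.ofReal_tsum, ← tsum_mul_left]
      refine tsum_congr fun n => ?_
      simp [Complex.mul_conj']
      ring
    · rintro ⟨m, n⟩ h
      by_contra h'
      apply h
      have : m ≠ n := fun e => h' ⟨m, by simp [e]⟩
      simp [sub_eq_zero, this]
  · intro p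
    refine (Continuous.integrableOn_Icc (a := -π) (b := π) ?_).mono_set Ioo_subset_Icc_self
    fun_prop
  · have (p : ℕ × ℕ) (θ : ℝ) : ‖d p.1 * starRingEnd ℂ (d p.2) *
        Complex.exp (((p.1 - p.2 : ℤ) : ℂ) * θ * Complex.I)‖ = ‖d p.1 * d p.2‖ := by
      rw [← hexp, norm_mul, RCLike.norm_conj, hn, hn, norm_mul]
    simp_rw [this]
    simp only [integral_const]
    exact (hd.mul_norm hd).const_smul _

theorem lintegral_Ioo_pow (n : ℕ) :
    ∫⁻ r in Ioo (0 : ℝ) 1, ENNReal.ofReal (r ^ n) = ENNReal.ofReal (1 / (n + 1)) := by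
  rw [← ofReal_integral_eq_lintegral_ofReal
      ((continuous_pow n).integrableOn_Icc.mono_set Ioo_subset_Icc_self)
      ((ae_restrict_mem measurableSet_Ioo).mono fun r hr => pow_nonneg hr.1.le n),
    ← integral_Ioc_eq_integral_Ioo, ← intervalIntegral.integral_of_le zero_le_one, integral_pow]
  simp

theorem lintegral_ball_normSq_tsum {F : ℂ → ℂ} (hF : Measurable F) {c : ℕ → ℂ}
    (hc : ∀ r : ℝ, 0 ≤ r → r < 1 → Summable fun n => ‖c n‖ * r ^ n)
    (hFc : ∀ z ∈ Metric.ball (0 : ℂ) 1, F z = ∑' n, c n * z ^ n) :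
    ∫⁻ z in Metric.ball (0 : ℂ) 1, ENNReal.ofReal (‖F z‖ ^ 2)
      = ENNReal.ofReal π * ∑' n : ℕ, ENNReal.ofReal (‖c n‖ ^ 2 / (n + 1)) := by
  have hm : Measurable fun z => (Metric.ball (0 : ℂ) 1).indicator
      (fun z => ENNReal.ofReal (‖F z‖ ^ 2)) z :=
    (by fun_prop : Measurable fun z => ENNReal.ofReal (‖F z‖ ^ 2)).indicator
      Metric.isOpen_ball.measurableSet
  rw [← lintegral_indicator Metric.isOpen_ball.measurableSet,
    ← Complex.lintegral_comp_polarCoord_symm]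
  have hsymm (p : ℝ × ℝ) :
      Complex.polarCoord.symm p = p.1 * Complex.exp (p.2 * Complex.I) := by
    rw [Complex.polarCoord_symm_apply, Complex.exp_mul_I, Complex.ofReal_cos, Complex.ofReal_sin]
  simp_rw [hsymm]
  rw [polarCoord_target, Measure.volume_eq_prod, setLIntegral_prod _ (by
      refine Measurable.aemeasurable ?_
      simp only [smul_eq_mul]
      exact (by fun_prop : Measurable fun p : ℝ × ℝ => ENNReal.ofReal p.1).mul
        (hm.comp (by fun_prop)))]
  have hin (r : ℝ) (hr : r ∈ Ioi (0 : ℝ)) :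
      ∫⁻ θ in Ioo (-π) π, ENNReal.ofReal r • (Metric.ball (0 : ℂ) 1).indicator
        (fun z => ENNReal.ofReal (‖F z‖ ^ 2)) (r * Complex.exp (θ * Complex.I)) =
      (Ioo (0 : ℝ) 1).indicator (fun r => ∑' n : ℕ,
        ENNReal.ofReal (2 * π) * ENNReal.ofReal (‖c n‖ ^ 2) *
          ENNReal.ofReal (r ^ (2 * n + 1))) r := by
    have hr0 : 0 < r := hr
    have hnorm (θ : ℝ) : ‖(r : ℂ) * Complex.exp (θ * Complex.I)‖ = r := by
      rw [norm_mul, Complex.norm_exp_ofReal_mul_I, mul_one, Complex.norm_of_nonneg hr0.le]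
    by_cases h1 : r < 1
    · have hmem (θ : ℝ) : (r : ℂ) * Complex.exp (θ * Complex.I) ∈ Metric.ball (0 : ℂ) 1 := by
        rw [mem_ball_zero_iff, hnorm]; exact h1
      have hval (θ : ℝ) : F (r * Complex.exp (θ * Complex.I)) =
          ∑' n : ℕ, c n * r ^ n * Complex.exp (n * θ * Complex.I) := by
        rw [hFc _ (hmem θ)]
        refine tsum_congr fun n => ?_
        rw [mul_pow, ← Complex.exp_nat_mul]
        ring_nf
      simp_rw [indicator_of_mem (hmem _), hval, smul_eq_mul]
      rw [lintegral_const_mul' _ _ ENNReal.ofReal_ne_top, lintegral_normSq_tsum_exp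
        (by simpa [abs_of_pos hr0] using hc r hr0.le h1), indicator_of_mem (mem_Ioo.2 ⟨hr0, h1⟩),
        ← mul_assoc, ← ENNReal.tsum_mul_left]
      refine tsum_congr fun n => ?_
      rw [mul_comm (ENNReal.ofReal r), mul_assoc, mul_assoc]
      congr 1
      rw [← ENNReal.ofReal_mul hr0.le, ← ENNReal.ofReal_mul (by positivity)]
      congr 1
      simp only [norm_mul, norm_pow, Complex.norm_real, Real.norm_eq_abs, abs_of_pos hr0]
      ring
    · have hmem (θ : ℝ) : (r : ℂ) * Complex.exp (θ * Complex.I) ∉ Metric.ball (0 : ℂ) 1 := by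
        rw [mem_ball_zero_iff, hnorm]; exact h1
      rw [indicator_of_notMem (fun h => h1 h.2)]
      simp_rw [indicator_of_notMem (hmem _)]
      simp
  rw [setLIntegral_congr_fun measurableSet_Ioi hin, lintegral_indicator measurableSet_Ioo,
    Measure.restrict_restrict measurableSet_Ioo, inter_eq_left.2 Ioo_subset_Ioi_self,
    lintegral_tsum fun n => by fun_prop, ← ENNReal.tsum_mul_left]
  refine tsum_congr fun n => ?_
  rw [lintegral_const_mul _ (by fun_prop), lintegral_Ioo_pow, ← ENNReal.ofReal_mul (by positivity),
    ← ENNReal.ofReal_mul (by positivity), ← ENNReal.ofReal_mul (by positivity)]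
  congr 1
  push_cast
  field_simp
  ring

theorem summable_succ_mul_norm_mul_pow {b : ℕ → ℂ} (hb : Summable fun n => ‖b n‖) {r : ℝ}
    (h0 : 0 ≤ r) (h1 : r < 1) : Summable fun n : ℕ => ‖(n + 1) * b (n + 1)‖ * r ^ n := by
  have h := ((summable_pow_mul_geometric_of_norm_lt_one 1 (r := r)
    (by rwa [Real.norm_eq_abs, abs_of_nonneg h0])).add
    (summable_geometric_of_lt_one h0 h1)).mul_left (∑' n, ‖b n‖)
  refine .of_nonneg_of_le (fun n => by positivity) (fun n => ?_) h
  have hle := hb.le_tsum (n + 1) fun _ _ => norm_nonneg _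
  have hn : ‖(n + 1 : ℂ)‖ = n + 1 := by exact_mod_cast Complex.norm_natCast (n + 1)
  rw [norm_mul, hn, pow_one]
  calc (n + 1) * ‖b (n + 1)‖ * r ^ n ≤ (n + 1) * (∑' n, ‖b n‖) * r ^ n := by gcongr
    _ = _ := by ring

theorem hasDerivAt_tsum_mul_pow {b : ℕ → ℂ} (hb : Summable fun n => ‖b n‖) {z : ℂ}
    (hz : z ∈ Metric.ball (0 : ℂ) 1) :
    HasDerivAt (fun w => ∑' n, b n * w ^ n) (∑' n : ℕ, (n + 1) * b (n + 1) * z ^ n) z := by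
  obtain ⟨r, hzr, hr1⟩ := exists_between (mem_ball_zero_iff.1 hz)
  have hr0 : 0 ≤ r := (norm_nonneg z).trans hzr.le
  have hu : Summable fun n : ℕ => ‖(n : ℂ) * b n‖ * r ^ (n - 1) := by
    rw [← summable_nat_add_iff 1]
    simpa using summable_succ_mul_norm_mul_pow hb hr0 hr1
  have hbound (n : ℕ) (y : ℂ) (hy : y ∈ Metric.ball (0 : ℂ) r) :
      ‖b n * (n * y ^ (n - 1))‖ ≤ ‖(n : ℂ) * b n‖ * r ^ (n - 1) := by
    rw [← mul_assoc, mul_comm (b n), norm_mul, norm_pow]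
    gcongr
    exact (mem_ball_zero_iff.1 hy).le
  have hzr' : z ∈ Metric.ball (0 : ℂ) r := mem_ball_zero_iff.2 hzr
  have h := hasDerivAt_tsum_of_isPreconnected hu Metric.isOpen_ball
    (convex_ball (0 : ℂ) r).isPreconnected
    (fun n y _ => (hasDerivAt_pow n y).const_mul (b n)) hbound hzr'
    (.of_norm_bounded hb fun n => by
      rw [norm_mul, norm_pow]
      exact mul_le_of_le_one_right (norm_nonneg _)
        (pow_le_one₀ (norm_nonneg _) (hzr.trans hr1).le)) hzr'
  suffices hs : ∑' n : ℕ, (n + 1) * b (n + 1) * z ^ n = ∑' n : ℕ, b n * (n * z ^ (n - 1)) by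
    rwa [hs]
  rw [(Summable.of_norm_bounded hu fun n => hbound n z hzr').tsum_eq_zero_add]
  simp only [Nat.cast_zero, zero_mul, mul_zero, zero_add, Nat.cast_add, Nat.cast_one,
    Nat.add_sub_cancel]
  exact tsum_congr fun n => by ring

theorem lintegral_ball_normSq_deriv {b : ℕ → ℂ} (hb : Summable fun n => ‖b n‖) :
    ∫⁻ z in Metric.ball (0 : ℂ) 1, ENNReal.ofReal (‖deriv (fun w => ∑' n, b n * w ^ n) z‖ ^ 2)
      = ENNReal.ofReal π * ∑' n : ℕ, ENNReal.ofReal (n * ‖b n‖ ^ 2) := by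
  rw [lintegral_ball_normSq_tsum (measurable_deriv _)
    (fun r h0 h1 => summable_succ_mul_norm_mul_pow hb h0 h1)
    fun z hz => (hasDerivAt_tsum_mul_pow hb hz).deriv, tsum_eq_zero_add' (f := fun n : ℕ => ENNReal.ofReal (n * ‖b n‖ ^ 2)) ENNReal.summable]
  simp only [Nat.cast_zero, zero_mul, ENNReal.ofReal_zero, zero_add]
  congr 1
  refine tsum_congr fun n => ?_
  have hn : ‖(n + 1 : ℂ)‖ = n + 1 := by exact_mod_cast Complex.norm_natCast (n + 1)
  rw [norm_mul, hn]
  congr 1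
  push_cast
  field_simp

theorem lintegral_ball_comp_conj (g : ℂ → ENNReal) :
    ∫⁻ z in Metric.ball (0 : ℂ) 1, g (starRingEnd ℂ z) = ∫⁻ z in Metric.ball (0 : ℂ) 1, g z := by
  have h := (Complex.conjLIE.measurePreserving).setLIntegral_comp_preimage_emb
    Complex.conjLIE.toHomeomorph.measurableEmbedding g (Metric.ball (0 : ℂ) 1)
  rw [LinearIsometryEquiv.preimage_ball] at h
  simpa using h

theorem normSq_fderiv_add_comp_conj {g h : ℂ → ℂ} {g' h' z : ℂ} (hg : HasDerivAt g g' z)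
    (hh : HasDerivAt h h' (starRingEnd ℂ z)) :
    ‖fderiv ℝ (fun w => g w + h (starRingEnd ℂ w)) z 1‖ ^ 2 +
      ‖fderiv ℝ (fun w => g w + h (starRingEnd ℂ w)) z Complex.I‖ ^ 2 =
      2 * ‖g'‖ ^ 2 + 2 * ‖h'‖ ^ 2 := by
  have hconj : HasFDerivAt (starRingEnd ℂ : ℂ → ℂ) (Complex.conjCLE : ℂ →L[ℝ] ℂ) z :=
    Complex.conjCLE.hasFDerivAt
  have H := (hg.hasFDerivAt.restrictScalars ℝ).add
    ((hh.hasFDerivAt.restrictScalars ℝ).comp z hconj)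
  have H' : fderiv ℝ (fun w => g w + h (starRingEnd ℂ w)) z = _ := H.fderiv
  rw [H']
  simp [Complex.sq_norm, Complex.normSq_apply]
  ring

/-- Dirichlet energy of the harmonic extension in terms of the boundary Fourier
coefficients: if `∑_{k∈ℤ} |a k| < ∞` and `f` is defined on the open unit disc by
`f(z) = ∑_{k≥0} a k zᵏ + ∑_{k≥1} a (−k) z̄ᵏ` (the harmonic extension of
`θ ↦ ∑ a k e^{ikθ}`), then, as an identity in `[0,∞]`,
`∫_D (|∂f/∂x|² + |∂f/∂y|²) dA = 2π ∑_{k∈ℤ} |k| |a k|²`. -/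
theorem dirichlet_energy_harmonic_extension
    (a : ℤ → ℂ) (hsum : Summable fun k : ℤ => ‖a k‖)
    (f : ℂ → ℂ)
    (hf : ∀ z ∈ Metric.ball (0 : ℂ) 1,
      f z = (∑' k : ℕ, a (k : ℤ) * z ^ k)
        + ∑' k : ℕ, a (-(k : ℤ) - 1) * (starRingEnd ℂ z) ^ (k + 1)) :
    (∫⁻ z in Metric.ball (0 : ℂ) 1,
        ENNReal.ofReal (‖fderiv ℝ f z 1‖ ^ 2 + ‖fderiv ℝ f z Complex.I‖ ^ 2))
      = ENNReal.ofReal (2 * π) * ∑' k : ℤ, ENNReal.ofReal (|(k : ℝ)| * ‖a k‖ ^ 2) := by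
  set b : ℕ → ℂ := fun n => a n with hb_def
  set c : ℕ → ℂ := fun n => if n = 0 then 0 else a (-(n : ℤ)) with hc_def
  have hb : Summable fun n => ‖b n‖ := hsum.comp_injective Nat.cast_injective
  have hc_succ (k : ℕ) : c (k + 1) = a (-(k : ℤ) - 1) := by
    simp only [hc_def, Nat.succ_ne_zero, if_false]
    congr 1
    push_cast
    ring
  have hc : Summable fun n => ‖c n‖ := by
    refine .of_nonneg_of_le (fun n => norm_nonneg _) (fun n => ?_)
      (hsum.comp_injective (i := fun n : ℕ => -(n : ℤ))
        (neg_injective.comp Nat.cast_injective))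
    by_cases hn : n = 0 <;> simp [hc_def, hn]
  set g : ℂ → ℂ := fun w => ∑' n, b n * w ^ n with hg_def
  set h : ℂ → ℂ := fun w => ∑' n, c n * w ^ n with hh_def
  have hconj_mem {z : ℂ} (hz : z ∈ Metric.ball (0 : ℂ) 1) :
      starRingEnd ℂ z ∈ Metric.ball (0 : ℂ) 1 := by
    simpa using hz
  have hf' : ∀ z ∈ Metric.ball (0 : ℂ) 1, f z = g z + h (starRingEnd ℂ z) := by
    intro z hz
    have hs : Summable fun n => c n * starRingEnd ℂ z ^ n :=
      .of_norm_bounded hc fun n => by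
        rw [norm_mul, norm_pow]
        exact mul_le_of_le_one_right (norm_nonneg _)
          (pow_le_one₀ (norm_nonneg _) (mem_ball_zero_iff.1 (hconj_mem hz)).le)
    rw [hf z hz, show h (starRingEnd ℂ z) = _ from hs.tsum_eq_zero_add]
    simp only [hc_succ]
    simp [hc_def, hg_def, hb_def]
  have henergy : ∀ z ∈ Metric.ball (0 : ℂ) 1,
      ENNReal.ofReal (‖fderiv ℝ f z 1‖ ^ 2 + ‖fderiv ℝ f z Complex.I‖ ^ 2) =
        2 * ENNReal.ofReal (‖deriv g z‖ ^ 2) +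
          2 * ENNReal.ofReal (‖deriv h (starRingEnd ℂ z)‖ ^ 2) := by
    intro z hz
    have heq : f =ᶠ[nhds z] fun w => g w + h (starRingEnd ℂ w) :=
      Filter.eventually_of_mem (Metric.isOpen_ball.mem_nhds hz) hf'
    rw [heq.fderiv_eq, normSq_fderiv_add_comp_conj
      (hasDerivAt_tsum_mul_pow hb hz).differentiableAt.hasDerivAt
      (hasDerivAt_tsum_mul_pow hc (hconj_mem hz)).differentiableAt.hasDerivAt,
      ENNReal.ofReal_add (by positivity) (by positivity), ENNReal.ofReal_mul zero_le_two,
      ENNReal.ofReal_mul zero_le_two, ENNReal.ofReal_ofNat]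
  have hmeas (u : ℂ → ℂ) : Measurable fun z => ENNReal.ofReal (‖deriv u z‖ ^ 2) :=
    ((measurable_deriv u).norm.pow_const 2).ennreal_ofReal
  rw [setLIntegral_congr_fun Metric.isOpen_ball.measurableSet henergy,
    lintegral_add_left ((hmeas g).const_mul 2), lintegral_const_mul' _ _ ENNReal.ofNat_ne_top,
    lintegral_const_mul' _ _ ENNReal.ofNat_ne_top,
    lintegral_ball_comp_conj (fun z => ENNReal.ofReal (‖deriv h z‖ ^ 2)),
    lintegral_ball_normSq_deriv hb, lintegral_ball_normSq_deriv hc,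
    tsum_of_nat_of_neg_add_one ENNReal.summable ENNReal.summable,
    tsum_eq_zero_add' (f := fun n : ℕ => ENNReal.ofReal (n * ‖c n‖ ^ 2)) ENNReal.summable,
    ENNReal.ofReal_mul zero_le_two, ENNReal.ofReal_ofNat, ← mul_add, ← mul_add, mul_assoc]
  have habs (k : ℕ) : |((-(k : ℤ) - 1 : ℤ) : ℝ)| = (k + 1 : ℕ) := by
    push_cast
    rw [← neg_add', abs_neg, abs_of_nonneg (by positivity)]
  simp only [hc_succ, hb_def, habs, neg_add', Int.cast_natCast, Nat.abs_cast, Nat.cast_zero,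
    zero_mul, ENNReal.ofReal_zero, zero_add]
end
end
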